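/- arXiv:2410.06095 — 2 statements merged into one kernel-verified Lean document; each statement's English description precedes it below -/
import Mathlib

section
/- Let G ∼ G(n,p) for some p = p_n satisfying 0.9/n ≤ p ≤ (1+(log n)^{-40})/n. Then with high probability G satisfies the following property: for every pair of distinct vertices u, v such that u and v receive the same colour in the stable colouring R*σ, there is some i ≤ 10·log n with S^i_G({u,v}) = ∅. -/
open MeasureTheory Filter

/-- Product of (independent) Bernoulli distributions on `ι → Bool`, with
success probability `q i` in coordinate `i`. -/
noncomputable def bernoulliProduct (ι : Type*) [Fintype ι] [DecidableEq ι] (q : ι → ℝ) :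
    Measure (ι → Bool) :=
  ∑ f : ι → Bool,
    (∏ i : ι, if f i then ENNReal.ofReal (q i) else ENNReal.ofReal (1 - q i)) •
      Measure.dirac f

/-- The Erdős–Rényi measure: each (potential) edge of the complete graph on `Fin n`
is present independently with probability `p`; encoded as a random `Sym2 (Fin n) → Bool`. -/
noncomputable def erdosRenyiMeasure (n : ℕ) (p : ℝ) : Measure (Sym2 (Fin n) → Bool) :=
  bernoulliProduct (Sym2 (Fin n)) fun _ => p

/-- The graph on `Fin n` determined by an edge-indicator function. -/
def graphOfFlip {n : ℕ} (f : Sym2 (Fin n) → Bool) : SimpleGraph (Fin n) :=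
  SimpleGraph.fromRel fun u v => f s(u, v) = true

/-- Symmetric difference of two graphs on the same vertex set. -/
def symmDiffG {V : Type*} (G₁ G₂ : SimpleGraph V) : SimpleGraph V :=
  SimpleGraph.fromRel fun u v => Xor' (G₁.Adj u v) (G₂.Adj u v)

/-- `crEquiv G c t u v` : vertices `u` and `v` get the same colour after `t` rounds of
colour refinement on `G`, starting from the colouring `c`. -/
def crEquiv {V : Type*} {Ω : Type*} (G : SimpleGraph V) (c : V → Ω) : ℕ → V → V → Prop
  | 0, u, v => c u = c v
  | (t + 1), u, v => crEquiv G c t u v ∧ ∀ w : V,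
      Nat.card {x : V // G.Adj u x ∧ crEquiv G c t x w} =
      Nat.card {x : V // G.Adj v x ∧ crEquiv G c t x w}

/-- `u` and `v` get the same colour in the stable colouring `R* c`. -/
def crStable {V : Type*} {Ω : Type*} (G : SimpleGraph V) (c : V → Ω) (u v : V) : Prop :=
  ∀ t, crEquiv G c t u v

/-- `u` and `v` get the same colour in the stable colouring `R* σ`
(colour refinement started from the trivial colouring). -/
def crStableTrivial {V : Type*} (G : SimpleGraph V) (u v : V) : Prop :=
  crStable G (fun _ => (0 : ℕ)) u v

/-- Equality of the initial pair-colourings `φ_{G,c}` on two ordered pairs of vertices. -/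
def wl2Init {V : Type*} {Ω : Type*} (G : SimpleGraph V) (c : V → Ω) (p q : V × V) : Prop :=
  (G.Adj p.1 p.2 ↔ G.Adj q.1 q.2) ∧ (p.1 = p.2 ↔ q.1 = q.2) ∧
    (p.1 = p.2 → q.1 = q.2 → c p.2 = c q.2)

/-- `wl2Equiv G c t p q` : the ordered pairs `p` and `q` get the same colour after `t` rounds of
the 2-dimensional Weisfeiler–Leman refinement on `G`, started from `φ_{G,c}`. -/
def wl2Equiv {V : Type*} {Ω : Type*} (G : SimpleGraph V) (c : V → Ω) :
    ℕ → V × V → V × V → Prop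
  | 0, p, q => wl2Init G c p q
  | (t + 1), p, q => wl2Equiv G c t p q ∧ ∀ r s : V × V,
      Nat.card {w : V // wl2Equiv G c t (p.1, w) r ∧ wl2Equiv G c t (w, p.2) s} =
      Nat.card {w : V // wl2Equiv G c t (q.1, w) r ∧ wl2Equiv G c t (w, q.2) s}

/-- `u` and `v` get the same colour in the vertex colouring `V* c` obtained from the stable
pair colouring of the 2-dimensional Weisfeiler–Leman algorithm started from `φ_{G,c}`. -/
def wl2VertexEquiv {V : Type*} {Ω : Type*} (G : SimpleGraph V) (c : V → Ω) (u v : V) : Prop :=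
  ∀ t, wl2Equiv G c t (u, u) (v, v)

/-- Given a colouring of `V(H)` encoded as the equivalence relation `r` ("has the same colour"),
`majority H r u v` says that at least half of the possible edges between the colour class of `u`
and the colour class of `v` are present in `H` (counting ordered pairs). -/
def majority {V : Type*} (H : SimpleGraph V) (r : V → V → Prop) (u v : V) : Prop :=
  Nat.card {p : V × V // p.1 ≠ p.2 ∧ r p.1 u ∧ r p.2 v} ≤
    2 * Nat.card {p : V × V // p.1 ≠ p.2 ∧ r p.1 u ∧ r p.2 v ∧ H.Adj p.1 p.2}

/-- The disparity graph `D(H,c)`, for the colouring encoded by the relation `r`. -/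
def disparity {V : Type*} (H : SimpleGraph V) (r : V → V → Prop) : SimpleGraph V :=
  SimpleGraph.fromRel fun u v => Xor' (H.Adj u v) (majority H r u v)

/-- The generalised disparity graph `D_L(H,c)` for a 0-1 matrix `L` on colours. -/
def gDisparity {V : Type*} {Ω : Type*} (H : SimpleGraph V) (c : V → Ω) (L : Ω → Ω → Bool) :
    SimpleGraph V :=
  SimpleGraph.fromRel fun u v => Xor' (H.Adj u v) (L (c u) (c v) = true)

/-- The vertex set of the connected component of `v` in `G`. -/
def compSet {V : Type*} (G : SimpleGraph V) (v : V) : Set V := {u | G.Reachable v u}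

/-- A colouring is equitable if any two vertices with the same colour have the same number of
neighbours in every colour class. -/
def IsEquitable {V : Type*} {Ω : Type*} (H : SimpleGraph V) (c : V → Ω) : Prop :=
  ∀ u v, c u = c v → ∀ a : Ω,
    Nat.card {x : V // H.Adj u x ∧ c x = a} = Nat.card {x : V // H.Adj v x ∧ c x = a}

/-- Vertex set of the `k`-core of `G`: the union of all vertex sets inducing minimum
degree at least `k`. -/
def kCore {V : Type*} (G : SimpleGraph V) (k : ℕ) : Set V :=
  ⋃₀ {S : Set V | ∀ v ∈ S, k ≤ Nat.card {u : V // u ∈ S ∧ G.Adj v u}}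

/-- `V_{2,3}(G)`: vertices of the 2-core of `G` having degree at least 3 in the 2-core. -/
def V23 {V : Type*} (G : SimpleGraph V) : Set V :=
  {v | v ∈ kCore G 2 ∧ 3 ≤ Nat.card {u : V // u ∈ kCore G 2 ∧ G.Adj v u}}

/-- The graph obtained from `G` by deleting all edges meeting `T`
(so that reachability in `avoidG G T` from `v ∉ T` is reachability in `G - T`). -/
def avoidG {V : Type*} (G : SimpleGraph V) (T : Set V) : SimpleGraph V :=
  SimpleGraph.fromRel fun u v => G.Adj u v ∧ u ∉ T ∧ v ∉ T

/-- `V_{2,3}^{safe}(G)`: vertices `v ∈ V_{2,3}(G)` such that after deleting any set of at most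
two other vertices, the component of `v` still contains at least 3 vertices of `V_{2,3}(G)`. -/
def V23safe {V : Type*} (G : SimpleGraph V) : Set V :=
  {v | v ∈ V23 G ∧ ∀ T : Finset V, T.card ≤ 2 → v ∉ T →
    3 ≤ Nat.card {w : V // w ∈ V23 G ∧ (avoidG G (T : Set V)).Reachable v w}}

open Classical in
/-- `Lmul G i u v w` is the multiplicity of the vertex `w` in the multiset `L^i_G(u,v)`. -/
noncomputable def Lmul {V : Type*} [Fintype V] (G : SimpleGraph V) : ℕ → V → V → V → ℕ
  | 0, u, _, w => if w = u then 1 else 0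
  | (i + 1), u, v, w =>
      (∑ x : V, if G.Adj w x then Lmul G i u v x else 0) -
        (∑ x : V, if G.Adj w x then Lmul G i v u x else 0)

/-- Union over `j < i` of the supports of `L^j_G(u,v)` and `L^j_G(v,u)`. -/
noncomputable def Sbelow {V : Type*} [Fintype V] (G : SimpleGraph V) (u v : V) (i : ℕ) :
    Set V :=
  {w | ∃ j < i, 0 < Lmul G j u v w ∨ 0 < Lmul G j v u w}

/-- `S^{≤ i}_G({u,v})`. -/
noncomputable def Sle {V : Type*} [Fintype V] (G : SimpleGraph V) (u v : V) (i : ℕ) : Set V :=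
  Sbelow G u v (i + 1)

/-- `S^{i}_G({u,v}) = S^{≤ i}_G({u,v}) \ S^{≤ i-1}_G({u,v})`. -/
noncomputable def Sat {V : Type*} [Fintype V] (G : SimpleGraph V) (u v : V) (i : ℕ) : Set V :=
  Sbelow G u v (i + 1) \ Sbelow G u v i

/-- Degree of a vertex (as `Nat.card` of the neighbour set, avoiding decidability issues). -/
noncomputable def ncDegree {V : Type*} (G : SimpleGraph V) (v : V) : ℕ :=
  Nat.card {u : V // G.Adj v u}

/-- The random refinement of a colouring `c`: each vertex `v` with `f v = true` receives
a brand-new colour unique to itself. -/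
def refineColor {V : Type*} {Ω : Type*} (c : V → Ω) (f : V → Bool) : V → Ω ⊕ V :=
  fun v => if f v then Sum.inr v else Sum.inl (c v)

/-- `D(H,c)` (for the colouring encoded by the relation `r`) is `s`-bounded: every
intersection of a colour class with a connected component of `D(H,c)` has at most
`s` elements. -/
def sBounded {V : Type*} (H : SimpleGraph V) (r : V → V → Prop) (s : ℕ) : Prop :=
  ∀ u v : V, Nat.card {w : V // r w u ∧ w ∈ compSet (disparity H r) v} ≤ s

/-- The type of canonical colours after `t` rounds of colour refinement. -/
def CCol : ℕ → Type
  | 0 => Unit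
  | (t + 1) => CCol t × Multiset (CCol t)

open Classical in
/-- The canonical colour of a vertex after `t` rounds of colour refinement. -/
noncomputable def canonColor {V : Type*} [Fintype V] (G : SimpleGraph V) :
    (t : ℕ) → V → CCol t
  | 0, _ => ()
  | (t + 1), v =>
      (canonColor G t v, (Finset.univ.filter fun w => G.Adj v w).val.map (canonColor G t))

/-- The modal probability `M(m,p)` of a `Binomial(m,p)` random variable. -/
noncomputable def modalProb (m : ℕ) (p : ℝ) : ℝ :=
  (m.choose ⌊(m + 1 : ℝ) * p⌋₊ : ℝ) * p ^ ⌊(m + 1 : ℝ) * p⌋₊ *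
    (1 - p) ^ (m - ⌊(m + 1 : ℝ) * p⌋₊)


section Probability

variable {ι : Type*} [Fintype ι]

/-- The weight of a configuration under independent Bernoulli bits with parameter `p`. -/
noncomputable def bitWeight (p : ℝ) (f : ι → Bool) : ℝ :=
  ∏ i, if f i then p else 1 - p

lemma bitWeight_nonneg {p : ℝ} (h0 : 0 ≤ p) (h1 : p ≤ 1) (f : ι → Bool) :
    0 ≤ bitWeight p f :=
  Finset.prod_nonneg fun i _ => by split_ifs <;> linarith

variable [DecidableEq ι]

open Classical in
/-- The probability of an event under independent Bernoulli bits with parameter `p`. -/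
noncomputable def bitProb (p : ℝ) (S : Set (ι → Bool)) : ℝ :=
  ∑ f with f ∈ S, bitWeight p f

lemma bitProb_nonneg {p : ℝ} (h0 : 0 ≤ p) (h1 : p ≤ 1) (S : Set (ι → Bool)) :
    0 ≤ bitProb p S :=
  Finset.sum_nonneg fun f _ => bitWeight_nonneg h0 h1 f

lemma bitProb_mono {p : ℝ} (h0 : 0 ≤ p) (h1 : p ≤ 1) {S T : Set (ι → Bool)} (h : S ⊆ T) :
    bitProb p S ≤ bitProb p T := by
  classical
  refine Finset.sum_le_sum_of_subset_of_nonneg ?_ fun f _ _ => bitWeight_nonneg h0 h1 f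
  exact fun f hf => by simpa using h (by simpa using hf)

lemma bitProb_biUnion_le {p : ℝ} (h0 : 0 ≤ p) (h1 : p ≤ 1) {α : Type*} (s : Finset α)
    (S : α → Set (ι → Bool)) :
    bitProb p (⋃ a ∈ s, S a) ≤ ∑ a ∈ s, bitProb p (S a) := by
  classical
  simp only [bitProb, Finset.sum_filter]
  rw [Finset.sum_comm]
  refine Finset.sum_le_sum fun f _ => ?_
  have hw := bitWeight_nonneg h0 h1 f
  split_ifs with h
  · obtain ⟨a, ha, hf⟩ : ∃ a ∈ s, f ∈ S a := by simpa using h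
    refine le_trans (by simp [hf])
      (Finset.single_le_sum (f := fun a => if f ∈ S a then bitWeight p f else 0) ?_ ha)
    intro b _
    split_ifs <;> simp [hw]
  · exact Finset.sum_nonneg fun b _ => by split_ifs <;> simp [hw]

lemma mul_bitProb_le_sum {p : ℝ} (h0 : 0 ≤ p) (h1 : p ≤ 1) {α : Type*} (s : Finset α)
    (S : α → Set (ι → Bool)) (T : Set (ι → Bool)) (N : ℝ)
    (h : ∀ f ∈ T, ∃ t ⊆ s, N ≤ t.card ∧ ∀ a ∈ t, f ∈ S a) :
    N * bitProb p T ≤ ∑ a ∈ s, bitProb p (S a) := by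
  classical
  simp only [bitProb, Finset.sum_filter]
  rw [Finset.sum_comm, Finset.mul_sum]
  refine Finset.sum_le_sum fun f _ => ?_
  have hw := bitWeight_nonneg h0 h1 f
  have hn : ∀ a ∈ s, 0 ≤ if f ∈ S a then bitWeight p f else 0 := fun a _ => by
    split_ifs <;> simp [hw]
  split_ifs with hf
  · obtain ⟨t, hts, hN, ht⟩ := h f hf
    calc N * bitWeight p f ≤ t.card * bitWeight p f := by gcongr
      _ = ∑ a ∈ t, if f ∈ S a then bitWeight p f else 0 := by
        rw [Finset.sum_congr rfl fun a ha => if_pos (ht a ha), Finset.sum_const, nsmul_eq_mul]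
      _ ≤ _ := Finset.sum_le_sum_of_subset_of_nonneg hts fun a ha _ => hn a ha
  · simpa using Finset.sum_nonneg hn

lemma bitProb_union_le {p : ℝ} (h0 : 0 ≤ p) (h1 : p ≤ 1) (S T : Set (ι → Bool)) :
    bitProb p (S ∪ T) ≤ bitProb p S + bitProb p T := by
  have := bitProb_biUnion_le h0 h1 Finset.univ fun b : Bool => if b then S else T
  refine le_trans (bitProb_mono h0 h1 ?_) (this.trans (by simp))
  rintro f (h | h)
  · exact Set.mem_biUnion (x := true) (by simp) (by simpa using h)
  · exact Set.mem_biUnion (x := false) (by simp) (by simpa using h)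

lemma bitProb_cylinder (p : ℝ) (F : Finset ι) (h : ι → Bool) :
    bitProb p {f | ∀ i ∈ F, f i = h i} = ∏ i ∈ F, if h i then p else 1 - p := by
  classical
  have e : bitProb p {f | ∀ i ∈ F, f i = h i} =
      ∑ f ∈ Fintype.piFinset fun i => if i ∈ F then {h i} else Finset.univ,
        ∏ i, if f i then p else 1 - p := by
    refine Finset.sum_congr ?_ fun _ _ => rfl
    ext f
    simp only [Set.mem_ofPred_eq, Finset.mem_filter, Finset.mem_univ, true_and,
      Fintype.mem_piFinset]
    refine forall_congr' fun i => ?_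
    by_cases hi : i ∈ F <;> simp [hi]
  rw [e, ← Finset.prod_univ_sum (fun i => if i ∈ F then {h i} else Finset.univ)
    (fun _ b => if b then p else 1 - p), ← Finset.prod_subset (Finset.subset_univ F)]
  · exact Finset.prod_congr rfl fun i hi => by simp [hi]
  · intro i _ hi
    simp [hi]

lemma bitProb_univ (p : ℝ) : bitProb p (Set.univ : Set (ι → Bool)) = 1 := by
  simpa using bitProb_cylinder p (∅ : Finset ι) fun _ => true

lemma bitProb_inter_add_diff (p : ℝ) (S T : Set (ι → Bool)) :
    bitProb p (S ∩ T) + bitProb p (S \ T) = bitProb p S := by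
  classical
  simp only [bitProb]
  rw [← Finset.sum_filter_add_sum_filter_not (Finset.univ.filter fun f => f ∈ S)
    fun f => f ∈ T]
  simp only [Finset.filter_filter, Set.mem_inter_iff, Set.mem_sdiff]

lemma bitProb_cylinder_all_false (p : ℝ) {F D : Finset ι} (hFD : Disjoint F D)
    (h : ι → Bool) :
    bitProb p ({f | ∀ i ∈ F, f i = h i} ∩ {f | ∀ i ∈ D, f i = false}) =
      (1 - p) ^ D.card * bitProb p {f | ∀ i ∈ F, f i = h i} := by
  have e : {f : ι → Bool | ∀ i ∈ F, f i = h i} ∩ {f | ∀ i ∈ D, f i = false} =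
      {f | ∀ i ∈ F ∪ D, f i = if i ∈ D then false else h i} := by
    ext f
    simp only [Set.mem_inter_iff, Set.mem_ofPred_eq, Finset.mem_union]
    constructor
    · rintro ⟨h1, h2⟩ i hi
      split_ifs with hD
      · exact h2 i hD
      · exact h1 i (hi.resolve_right hD)
    · refine fun H => ⟨fun i hi => ?_, fun i hi => by simpa [hi] using H i (Or.inr hi)⟩
      simpa [Finset.disjoint_left.1 hFD hi] using H i (Or.inl hi)
  rw [e, bitProb_cylinder, bitProb_cylinder, Finset.prod_union hFD, mul_comm]
  congr 1
  · rw [← Finset.prod_const]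
    exact Finset.prod_congr rfl fun i hi => by simp [hi]
  · exact Finset.prod_congr rfl fun i hi => by simp [Finset.disjoint_left.1 hFD hi]

/-- If the bits in `τ f` are revealed (where `τ` and `A` only depend on the revealed bits), and
`B` then forces whether or not some bit of an unrevealed set `D` is present, then `B` has
conditional probability at most `c` given `A`. -/
lemma bitProb_inter_le_mul {p c : ℝ} (h0 : 0 ≤ p) (h1 : p ≤ 1) (τ : (ι → Bool) → Finset ι)
    (A B : Set (ι → Bool))
    (hτ : ∀ f g, (∀ i ∈ τ f, g i = f i) → τ g = τ f)
    (hA : ∀ f g, (∀ i ∈ τ f, g i = f i) → f ∈ A → g ∈ A)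
    (hB : ∀ f ∈ A, ∃ D : Finset ι, Disjoint (τ f) D ∧ (1 - p) ^ D.card ≤ c ∧
      1 - (1 - p) ^ D.card ≤ c ∧ ∀ g ∈ B, ∀ g' ∈ B, (∀ i ∈ τ f, g i = f i) →
        (∀ i ∈ τ f, g' i = f i) → (∀ i ∈ D, g i = false) → ∀ i ∈ D, g' i = false) :
    bitProb p (A ∩ B) ≤ c * bitProb p A := by
  classical
  let κ : (ι → Bool) → Finset ι × (ι → Bool) :=
    fun f => (τ f, fun i => if i ∈ τ f then f i else false)
  have hκ : ∀ f g, κ g = κ f ↔ ∀ i ∈ τ f, g i = f i := by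
    intro f g
    constructor
    · intro h i hi
      have h2 := congrFun (congrArg Prod.snd h) i
      have h3 : τ g = τ f := congrArg Prod.fst h
      simpa [κ, h3, hi] using h2
    · intro h
      have h3 := hτ f g h
      simp only [κ, h3, Prod.mk.injEq, true_and]
      funext i
      by_cases hi : i ∈ τ f <;> simp [hi, h i]
  have key : ∀ f ∈ A, bitProb p ({g | κ g = κ f} ∩ B) ≤ c * bitProb p {g | κ g = κ f} := by
    intro f hf
    obtain ⟨D, hD, hc1, hc2, hDB⟩ := hB f hf
    have e : {g | κ g = κ f} = {g | ∀ i ∈ τ f, g i = f i} := by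
      ext g
      exact hκ f g
    rw [e]
    set C := {g : ι → Bool | ∀ i ∈ τ f, g i = f i} with hC
    have hz := bitProb_cylinder_all_false p hD f
    have hnz := bitProb_inter_add_diff p C {g | ∀ i ∈ D, g i = false}
    rw [← hC] at hz
    have hpC := bitProb_nonneg h0 h1 C
    by_cases hex : ∃ g ∈ B, g ∈ C ∧ ∀ i ∈ D, g i = false
    · obtain ⟨g, hgB, hgC, hg⟩ := hex
      calc bitProb p (C ∩ B) ≤ bitProb p (C ∩ {g | ∀ i ∈ D, g i = false}) :=
            bitProb_mono h0 h1 fun g' hg' => ⟨hg'.1, hDB g hgB g' hg'.2 hgC hg'.1 hg⟩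
        _ ≤ _ := by rw [hz]; gcongr
    · push Not at hex
      calc bitProb p (C ∩ B) ≤ bitProb p (C \ {g | ∀ i ∈ D, g i = false}) := by
            refine bitProb_mono h0 h1 fun g' hg' => ⟨hg'.1, fun h => ?_⟩
            obtain ⟨i, hi, hne⟩ := hex g' hg'.2 hg'.1
            exact hne (h i hi)
        _ = (1 - (1 - p) ^ D.card) * bitProb p C := by linarith
        _ ≤ _ := by gcongr
  have split : ∀ S : Set (ι → Bool), S ⊆ A → bitProb p S =
      ∑ k ∈ (Finset.univ.filter fun f => f ∈ A).image κ, bitProb p ({g | κ g = k} ∩ S) := by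
    intro S hS
    rw [bitProb, ← Finset.sum_fiberwise_of_maps_to (g := κ)
      (t := (Finset.univ.filter fun f => f ∈ A).image κ)]
    · refine Finset.sum_congr rfl fun k _ => ?_
      rw [bitProb, Finset.filter_filter]
      refine Finset.sum_congr ?_ fun _ _ => rfl
      ext g
      simp [and_comm]
    · intro f hf
      exact Finset.mem_image_of_mem _ (by simpa using hS (by simpa using hf))
  rw [split _ Set.inter_subset_left, split A subset_rfl, Finset.mul_sum]
  refine Finset.sum_le_sum fun k hk => ?_
  obtain ⟨f, hf, rfl⟩ := Finset.mem_image.1 hk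
  have hfA : f ∈ A := by simpa using hf
  have hsub : {g | κ g = κ f} ⊆ A := fun g hg => hA f g ((hκ f g).1 hg) hfA
  rw [Set.inter_eq_left.2 hsub, ← Set.inter_assoc, Set.inter_eq_left.2 hsub]
  exact key f hfA

lemma bernoulliProduct_apply {p : ℝ} (h0 : 0 ≤ p) (h1 : p ≤ 1) (S : Set (ι → Bool)) :
    bernoulliProduct ι (fun _ => p) S = ENNReal.ofReal (bitProb p S) := by
  classical
  rw [bitProb, ENNReal.ofReal_sum_of_nonneg fun f _ => bitWeight_nonneg h0 h1 f,
    bernoulliProduct, Measure.finsetSum_apply, Finset.sum_filter]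
  refine Finset.sum_congr rfl fun f _ => ?_
  rw [Measure.smul_apply, Measure.dirac_apply' _ S.toFinite.measurableSet, bitWeight,
    ENNReal.ofReal_prod_of_nonneg fun i _ => by split_ifs <;> linarith]
  by_cases hf : f ∈ S
  · simp only [hf, Set.indicator_of_mem, Pi.one_apply, smul_eq_mul, mul_one, if_true]
    exact Finset.prod_congr rfl fun i _ => by split_ifs <;> rfl
  · simp [hf]

end Probability

lemma crEquiv_equivalence {V Ω : Type*} (G : SimpleGraph V) (c : V → Ω) (t : ℕ) :
    Equivalence (crEquiv G c t) := by
  induction t with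
  | zero => exact ⟨fun _ => rfl, fun h => h.symm, fun h h' => h.trans h'⟩
  | succ t ih =>
    exact ⟨fun x => ⟨ih.refl x, fun _ => rfl⟩, fun h => ⟨ih.symm h.1, fun w => (h.2 w).symm⟩,
      fun h h' => ⟨ih.trans h.1 h'.1, fun w => (h.2 w).trans (h'.2 w)⟩⟩

section Discrepancy

variable {V : Type*} [Fintype V]

open Classical in
/-- The number of walks of length `i` from `u` to `w` minus the number of those from `v`. -/
noncomputable def walkDisc (G : SimpleGraph V) (u v : V) : ℕ → V → ℤ
  | 0, w => (if w = u then 1 else 0) - (if w = v then 1 else 0)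
  | i + 1, w => ∑ x, if G.Adj w x then walkDisc G u v i x else 0

open Classical in
/-- The number of walks of length `i` from a vertex. -/
noncomputable def walkCount (G : SimpleGraph V) : ℕ → V → ℤ
  | 0, _ => 1
  | i + 1, w => ∑ x, if G.Adj w x then walkCount G i x else 0

lemma Lmul_eq_toNat_walkDisc (G : SimpleGraph V) {u v : V} (huv : u ≠ v) (i : ℕ) :
    ∀ w, Lmul G i u v w = (walkDisc G u v i w).toNat ∧
      Lmul G i v u w = (-walkDisc G u v i w).toNat := by
  classical
  induction i with
  | zero =>
    intro w
    by_cases h1 : w = u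
    · subst h1
      simp [Lmul, walkDisc, huv]
    · by_cases h2 : w = v
      · subst h2
        simp [Lmul, walkDisc, h1]
      · simp [Lmul, walkDisc, h1, h2]
  | succ i ih =>
    intro w
    have h : ((∑ x, if G.Adj w x then Lmul G i u v x else 0 : ℕ) : ℤ) -
        (∑ x, if G.Adj w x then Lmul G i v u x else 0 : ℕ) = walkDisc G u v (i + 1) w := by
      push_cast
      rw [← Finset.sum_sub_distrib, walkDisc]
      refine Finset.sum_congr rfl fun x _ => ?_
      have := ih x
      split_ifs
      · omega
      · rfl
    simp only [Lmul]
    omega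

lemma mem_Sbelow_iff (G : SimpleGraph V) {u v : V} (huv : u ≠ v) (i : ℕ) (w : V) :
    w ∈ Sbelow G u v i ↔ ∃ j < i, walkDisc G u v j w ≠ 0 := by
  refine exists_congr fun j => and_congr_right fun _ => ?_
  have := Lmul_eq_toNat_walkDisc G huv j w
  omega

lemma walkDisc_ne_zero_of_mem_Sat {G : SimpleGraph V} {u v : V} (huv : u ≠ v) {i : ℕ} {w : V}
    (hw : w ∈ Sat G u v i) : walkDisc G u v i w ≠ 0 := by
  obtain ⟨h1, h2⟩ := hw
  rw [mem_Sbelow_iff G huv] at h1 h2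
  obtain ⟨j, hj, hne⟩ := h1
  obtain rfl | hlt := (Nat.lt_succ_iff.1 hj).eq_or_lt
  · exact hne
  · exact absurd ⟨j, hlt, hne⟩ h2

lemma Sbelow_mono (G : SimpleGraph V) (u v : V) {i j : ℕ} (h : i ≤ j) :
    Sbelow G u v i ⊆ Sbelow G u v j :=
  fun _ ⟨k, hk, hw⟩ => ⟨k, hk.trans_le h, hw⟩

lemma walkDisc_congr {G H : SimpleGraph V} {u v : V} (huv : u ≠ v) {i : ℕ}
    (h : ∀ x ∈ Sbelow G u v i, ∀ y, G.Adj x y ↔ H.Adj x y) {j : ℕ} (hj : j ≤ i) :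
    walkDisc H u v j = walkDisc G u v j := by
  classical
  induction j with
  | zero => rfl
  | succ j ih =>
    funext w
    simp only [walkDisc, ih (by omega)]
    refine Finset.sum_congr rfl fun x _ => ?_
    by_cases hx : walkDisc G u v j x = 0
    · simp [hx]
    · have := h x ((mem_Sbelow_iff G huv i x).2 ⟨j, hj, hx⟩) w
      simp only [G.adj_comm w x, H.adj_comm w x, this]

lemma Sbelow_congr {G H : SimpleGraph V} {u v : V} (huv : u ≠ v) {i : ℕ}
    (h : ∀ x ∈ Sbelow G u v i, ∀ y, G.Adj x y ↔ H.Adj x y) {j : ℕ} (hj : j ≤ i + 1) :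
    Sbelow H u v j = Sbelow G u v j := by
  ext w
  rw [mem_Sbelow_iff H huv, mem_Sbelow_iff G huv]
  refine exists_congr fun k => and_congr_right fun hk => ?_
  rw [walkDisc_congr huv h (by omega)]

lemma Sat_congr {G H : SimpleGraph V} {u v : V} (huv : u ≠ v) {i : ℕ}
    (h : ∀ x ∈ Sbelow G u v i, ∀ y, G.Adj x y ↔ H.Adj x y) {j : ℕ} (hj : j ≤ i) :
    Sat H u v j = Sat G u v j := by
  rw [Sat, Sat, Sbelow_congr huv h (by omega), Sbelow_congr huv h (by omega)]

lemma sum_walkDisc_mul_walkCount_succ (G : SimpleGraph V) (u v : V) (i k : ℕ) :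
    ∑ w, walkDisc G u v (i + 1) w * walkCount G k w =
      ∑ w, walkDisc G u v i w * walkCount G (k + 1) w := by
  classical
  simp only [walkDisc, walkCount, Finset.sum_mul, Finset.mul_sum]
  rw [Finset.sum_comm]
  refine Finset.sum_congr rfl fun x _ => Finset.sum_congr rfl fun y _ => ?_
  simp only [G.adj_comm x y]
  split_ifs <;> simp

lemma sum_walkDisc (G : SimpleGraph V) (u v : V) (i : ℕ) :
    ∑ w, walkDisc G u v i w = walkCount G i u - walkCount G i v := by
  classical
  have h : ∀ i k, ∑ w, walkDisc G u v i w * walkCount G k w =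
      walkCount G (i + k) u - walkCount G (i + k) v := by
    intro i
    induction i with
    | zero => intro k; simp [walkDisc, sub_mul, Finset.sum_sub_distrib]
    | succ i ih =>
      intro k
      rw [sum_walkDisc_mul_walkCount_succ, ih, show i + (k + 1) = i + 1 + k by ring]
  simpa [walkCount] using h i 0

lemma walkCount_eq_of_crEquiv {Ω : Type*} (G : SimpleGraph V) (c : V → Ω) (t : ℕ) :
    ∀ u v, crEquiv G c t u v → walkCount G t u = walkCount G t v := by
  classical
  induction t with
  | zero => intro u v _; rfl
  | succ t ih =>
    intro u v h
    let s : Setoid V := ⟨crEquiv G c t, crEquiv_equivalence G c t⟩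
    have key : ∀ a, walkCount G (t + 1) a = ∑ q : Quotient s,
        (Nat.card {x : V // G.Adj a x ∧ crEquiv G c t x q.out} : ℤ) *
          walkCount G t q.out := by
      intro a
      rw [walkCount, ← Finset.sum_filter, ← Finset.sum_fiberwise_of_maps_to
        (g := fun x => (⟦x⟧ : Quotient s)) (t := Finset.univ) fun _ _ => Finset.mem_univ _]
      refine Finset.sum_congr rfl fun q _ => ?_
      have hq : ∀ x, (⟦x⟧ : Quotient s) = q ↔ crEquiv G c t x q.out := by
        intro x
        conv_lhs => rw [← Quotient.out_eq q]
        exact Quotient.eq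
      rw [Nat.card_eq_fintype_card, Fintype.card_subtype, ← nsmul_eq_mul,
        ← Finset.sum_const, Finset.filter_filter]
      simp only [hq]
      exact Finset.sum_congr rfl fun x hx => ih _ _ (Finset.mem_filter.1 hx).2.2
    rw [key, key]
    exact Finset.sum_congr rfl fun q _ => by rw [h.2]

lemma sum_walkDisc_eq_zero {G : SimpleGraph V} {u v : V} (h : crStableTrivial G u v) (i : ℕ) :
    ∑ w, walkDisc G u v i w = 0 := by
  rw [sum_walkDisc, walkCount_eq_of_crEquiv G _ i u v (h i), sub_self]

open Classical in
lemma sum_walkDisc_succ_eq_sum_mul_degree (G : SimpleGraph V) (u v : V) (i : ℕ) :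
    ∑ w, walkDisc G u v (i + 1) w =
      ∑ w, walkDisc G u v i w * ((Finset.univ.filter fun x => G.Adj w x).card : ℤ) := by
  have := sum_walkDisc_mul_walkCount_succ G u v i 0
  simpa [walkCount] using this

lemma exists_walk_of_walkDisc_ne_zero (G : SimpleGraph V) (u v : V) (i : ℕ) :
    ∀ w, walkDisc G u v i w ≠ 0 →
      (∃ q : G.Walk w u, q.length = i) ∨ ∃ q : G.Walk w v, q.length = i := by
  classical
  induction i with
  | zero =>
    intro w hw
    by_cases h1 : w = u
    · exact Or.inl ⟨SimpleGraph.Walk.nil.copy rfl h1, by simp⟩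
    · by_cases h2 : w = v
      · exact Or.inr ⟨SimpleGraph.Walk.nil.copy rfl h2, by simp⟩
      · simp [walkDisc, h1, h2] at hw
  | succ i ih =>
    intro w hw
    obtain ⟨x, -, hx⟩ := Finset.exists_ne_zero_of_sum_ne_zero hw
    have hadj : G.Adj w x := by
      by_contra h
      simp [h] at hx
    simp only [hadj, if_true] at hx
    obtain ⟨q, hq⟩ | ⟨q, hq⟩ := ih x hx
    · exact Or.inl ⟨q.cons hadj, by simp [hq]⟩
    · exact Or.inr ⟨q.cons hadj, by simp [hq]⟩

end Discrepancy

section Exploration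

lemma graphOfFlip_adj {n : ℕ} {f : Sym2 (Fin n) → Bool} {x y : Fin n} :
    (graphOfFlip f).Adj x y ↔ x ≠ y ∧ f s(x, y) = true := by
  simp [graphOfFlip, SimpleGraph.fromRel_adj, Sym2.eq_swap (a := y) (b := x)]

/-- The vertices discovered up to step `i`, except for one vertex discovered at step `i`. -/
def revealedVerts {V : Type*} [Fintype V] (G : SimpleGraph V) (u v : V) (i : ℕ) : Set V :=
  Sbelow G u v (i + 1) \ {w | ∃ h : (Sat G u v i).Nonempty, w = h.some}

lemma Sbelow_subset_revealedVerts {V : Type*} [Fintype V] (G : SimpleGraph V) (u v : V)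
    (i : ℕ) : Sbelow G u v i ⊆ revealedVerts G u v i := by
  refine fun x hx => ⟨Sbelow_mono G u v i.le_succ hx, ?_⟩
  rintro ⟨h, rfl⟩
  exact h.some_mem.2 hx

variable {n : ℕ}

open Classical in
/-- The pairs of vertices meeting `revealedVerts`. -/
noncomputable def revealedPairs (u v : Fin n) (i : ℕ) (f : Sym2 (Fin n) → Bool) :
    Finset (Sym2 (Fin n)) :=
  Finset.univ.filter fun e => ∃ x ∈ revealedVerts (graphOfFlip f) u v i, x ∈ e

/-- The discovery process of `u, v` keeps discovering new vertices up to step `i`, with balanced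
multisets, and at most half of the vertices are discovered. -/
def survives (u v : Fin n) (i : ℕ) : Set (Sym2 (Fin n) → Bool) :=
  {f | (∀ j ≤ i, (Sat (graphOfFlip f) u v j).Nonempty ∧
    ∑ w, walkDisc (graphOfFlip f) u v j w = 0) ∧
    2 * (Sbelow (graphOfFlip f) u v (i + 1)).ncard ≤ n}

lemma adj_iff_of_eq_on_revealedPairs {u v : Fin n} {i : ℕ} {f g : Sym2 (Fin n) → Bool}
    (h : ∀ e ∈ revealedPairs u v i f, g e = f e) {x : Fin n}
    (hx : x ∈ revealedVerts (graphOfFlip f) u v i) (y : Fin n) :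
    (graphOfFlip f).Adj x y ↔ (graphOfFlip g).Adj x y := by
  rw [graphOfFlip_adj, graphOfFlip_adj, h]
  simp only [revealedPairs, Finset.mem_filter, Finset.mem_univ, true_and]
  exact ⟨x, hx, Sym2.mem_mk_left x y⟩

lemma bitProb_survives_succ_le {p c : ℝ} (h0 : 0 ≤ p) (h1 : p ≤ 1) {u v : Fin n} (huv : u ≠ v)
    (hc : ∀ m ≤ n, n ≤ 2 * m → (1 - p) ^ m ≤ c ∧ 1 - (1 - p) ^ m ≤ c) (i : ℕ) :
    bitProb p (survives u v (i + 1)) ≤ c * bitProb p (survives u v i) := by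
  classical
  have hsub : survives u v (i + 1) ⊆ survives u v i ∩
      {f | ∑ w, walkDisc (graphOfFlip f) u v (i + 1) w = 0} := by
    rintro f ⟨h, hcard⟩
    refine ⟨⟨fun j hj => h j (by omega), le_trans ?_ hcard⟩, (h (i + 1) le_rfl).2⟩
    gcongr
    · exact Set.toFinite _
    · exact Sbelow_mono _ u v (by omega)
  refine (bitProb_mono h0 h1 hsub).trans ?_
  have hcongr : ∀ f g : Sym2 (Fin n) → Bool, (∀ e ∈ revealedPairs u v i f, g e = f e) →
      ∀ x ∈ Sbelow (graphOfFlip f) u v i, ∀ y,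
        (graphOfFlip f).Adj x y ↔ (graphOfFlip g).Adj x y := fun f g h x hx y =>
    adj_iff_of_eq_on_revealedPairs h (Sbelow_subset_revealedVerts _ u v i hx) y
  refine bitProb_inter_le_mul h0 h1 (revealedPairs u v i) _ _ ?_ ?_ ?_
  · intro f g h
    have hS := Sat_congr huv (hcongr f g h) le_rfl
    have hB := Sbelow_congr huv (hcongr f g h) le_rfl
    have : revealedVerts (graphOfFlip g) u v i = revealedVerts (graphOfFlip f) u v i := by
      simp only [revealedVerts, hS, hB]
    simp only [revealedPairs, this]
  · rintro f g h ⟨hf, hcard⟩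
    refine ⟨fun j hj => ?_, ?_⟩
    · rw [Sat_congr huv (hcongr f g h) hj, walkDisc_congr huv (hcongr f g h) hj]
      exact hf j hj
    · rwa [Sbelow_congr huv (hcongr f g h) le_rfl]
  · rintro f ⟨hf, hcard⟩
    obtain ⟨hne, -⟩ := hf i le_rfl
    set w := hne.some with hw
    have hwS : w ∈ Sat (graphOfFlip f) u v i := hne.some_mem
    have hrev : ∀ x, x ∈ revealedVerts (graphOfFlip f) u v i ↔
        x ∈ Sbelow (graphOfFlip f) u v (i + 1) ∧ x ≠ w := by
      intro x
      simp [revealedVerts, hne, hw]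
    let O : Finset (Fin n) := Finset.univ.filter fun x => x ∉ Sbelow (graphOfFlip f) u v (i + 1)
    let D : Finset (Sym2 (Fin n)) := O.image fun x => s(w, x)
    have hDcard : D.card = O.card :=
      Finset.card_image_of_injective _ fun x y h => Sym2.congr_right.1 h
    have hO : O.card + (Sbelow (graphOfFlip f) u v (i + 1)).ncard = n := by
      have := Finset.card_filter_add_card_filter_not (s := (Finset.univ : Finset (Fin n)))
        (fun x => x ∈ Sbelow (graphOfFlip f) u v (i + 1))
      rw [Finset.card_univ, Fintype.card_fin] at this
      have hB : (Sbelow (graphOfFlip f) u v (i + 1)).ncard = (Finset.univ.filter fun x =>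
          x ∈ Sbelow (graphOfFlip f) u v (i + 1)).card := by
        rw [← Set.ncard_coe_finset]
        simp
      simp only [O]
      omega
    obtain ⟨hc1, hc2⟩ := hc D.card (by omega) (by omega)
    refine ⟨D, ?_, hc1, hc2, ?_⟩
    · rw [Finset.disjoint_right]
      intro e he hr
      obtain ⟨y, hy, rfl⟩ := Finset.mem_image.1 he
      obtain ⟨x, hx, hxe⟩ := (Finset.mem_filter.1 hr).2
      have hx' := (hrev x).1 hx
      rcases Sym2.mem_iff.1 hxe with rfl | rfl
      · exact hx'.2 rfl
      · exact (Finset.mem_filter.1 hy).2 hx'.1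
    · intro g hgB g' hgB' hg hg' hgD
      have hdisc : ∀ h : Sym2 (Fin n) → Bool, (∀ e ∈ revealedPairs u v i f, h e = f e) →
          ∑ x, walkDisc (graphOfFlip h) u v (i + 1) x = 0 →
          ∑ x, walkDisc (graphOfFlip f) u v i x *
            ((Finset.univ.filter fun y => (graphOfFlip h).Adj x y).card : ℤ) = 0 := by
        intro h hh hsum
        rw [sum_walkDisc_succ_eq_sum_mul_degree,
          walkDisc_congr huv (hcongr f h hh) le_rfl] at hsum
        exact hsum
      have hadj : ∀ x ∈ revealedVerts (graphOfFlip f) u v i, ∀ y,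
          (graphOfFlip g).Adj x y ↔ (graphOfFlip g').Adj x y := fun x hx y =>
        (adj_iff_of_eq_on_revealedPairs hg hx y).symm.trans
          (adj_iff_of_eq_on_revealedPairs hg' hx y)
      have hdeg : (Finset.univ.filter fun y => (graphOfFlip g).Adj w y).card =
          (Finset.univ.filter fun y => (graphOfFlip g').Adj w y).card := by
        have e1 := hdisc g hg hgB
        have e2 := hdisc g' hg' hgB'
        rw [← Finset.add_sum_erase _ _ (Finset.mem_univ w)] at e1 e2
        have e3 : ∀ x ∈ Finset.univ.erase w, walkDisc (graphOfFlip f) u v i x *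
            ((Finset.univ.filter fun y => (graphOfFlip g).Adj x y).card : ℤ) =
            walkDisc (graphOfFlip f) u v i x *
            ((Finset.univ.filter fun y => (graphOfFlip g').Adj x y).card : ℤ) := by
          intro x hx
          by_cases hd : walkDisc (graphOfFlip f) u v i x = 0
          · simp [hd]
          · have hx' := (hrev x).2 ⟨(mem_Sbelow_iff _ huv _ x).2 ⟨i, i.lt_succ_self, hd⟩,
              Finset.ne_of_mem_erase hx⟩
            simp only [hadj x hx']
        rw [Finset.sum_congr rfl e3] at e1
        have hd := walkDisc_ne_zero_of_mem_Sat huv hwS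
        exact_mod_cast mul_left_cancel₀ hd (add_right_cancel (e1.trans e2.symm))
      have hnbr : (Finset.univ.filter fun y => (graphOfFlip g).Adj w y) ⊆
          Finset.univ.filter fun y => (graphOfFlip g').Adj w y := by
        intro y hy
        have hy := (Finset.mem_filter.1 hy).2
        have hyS : y ∈ Sbelow (graphOfFlip f) u v (i + 1) := by
          by_contra hyS
          have := hgD s(w, y) (Finset.mem_image_of_mem _ (by simpa [O] using hyS))
          simp [graphOfFlip_adj, this] at hy
        have hyr := (hrev y).2 ⟨hyS, hy.ne'⟩
        simpa using ((hadj y hyr w).1 hy.symm).symm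
      have heq := Finset.eq_of_subset_of_card_le hnbr hdeg.ge
      intro e he
      obtain ⟨y, hy, rfl⟩ := Finset.mem_image.1 he
      have hyO := (Finset.mem_filter.1 hy).2
      by_contra hne'
      have hwy : w ≠ y := by
        rintro rfl
        exact hyO hwS.1
      have : y ∈ Finset.univ.filter fun y => (graphOfFlip g').Adj w y := by
        simpa [graphOfFlip_adj, hwy] using hne'
      rw [← heq] at this
      have hgy := hgD _ he
      simp [graphOfFlip_adj, hgy] at this

lemma bitProb_survives_le_pow {p c : ℝ} (h0 : 0 ≤ p) (h1 : p ≤ 1) (hc0 : 0 ≤ c) {u v : Fin n}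
    (huv : u ≠ v) (hc : ∀ m ≤ n, n ≤ 2 * m → (1 - p) ^ m ≤ c ∧ 1 - (1 - p) ^ m ≤ c) (i : ℕ) :
    bitProb p (survives u v i) ≤ c ^ i := by
  induction i with
  | zero =>
    rw [pow_zero, ← bitProb_univ (ι := Sym2 (Fin n)) p]
    exact bitProb_mono h0 h1 (Set.subset_univ _)
  | succ i ih =>
    calc _ ≤ c * bitProb p (survives u v i) := bitProb_survives_succ_le h0 h1 huv hc i
      _ ≤ c * c ^ i := by gcongr
      _ = c ^ (i + 1) := by ring

end Exploration

section Neighbourhoods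

variable {n : ℕ}

/-- The pairs along `x` are all present. -/
def chainPresent {j : ℕ} (x : Fin (j + 1) → Fin n) : Set (Sym2 (Fin n) → Bool) :=
  {f | ∀ i : Fin j, f s(x i.castSucc, x i.succ) = true}

lemma bitProb_chainPresent (p : ℝ) {j : ℕ} {x : Fin (j + 1) → Fin n}
    (hx : Function.Injective x) : bitProb p (chainPresent x) = p ^ j := by
  classical
  let e : Fin j → Sym2 (Fin n) := fun i => s(x i.castSucc, x i.succ)
  have he : Function.Injective e := by
    intro a b hab
    rcases Sym2.eq_iff.1 hab with ⟨h1, -⟩ | ⟨h1, h2⟩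
    · exact Fin.castSucc_injective _ (hx h1)
    · have h1 := congrArg Fin.val (hx h1)
      have h2 := congrArg Fin.val (hx h2)
      simp only [Fin.val_castSucc, Fin.val_succ] at h1 h2
      omega
  have h : chainPresent x = {f | ∀ a ∈ Finset.univ.image e, f a = (fun _ => true) a} := by
    ext f
    simp [chainPresent, e]
  rw [h, bitProb_cylinder]
  simp [Finset.card_image_of_injective _ he]

lemma exists_chain_of_walk {f : Sym2 (Fin n) → Bool} {a b : Fin n}
    (q : (graphOfFlip f).Walk a b) : ∃ j ≤ q.length, ∃ x : Fin (j + 1) → Fin n,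
      Function.Injective x ∧ f ∈ chainPresent x ∧ x 0 = a ∧ x (Fin.last j) = b := by
  classical
  refine ⟨q.bypass.length, q.length_bypass_le_length, fun i => q.bypass.getVert i, ?_, ?_, ?_, ?_⟩
  · intro i i' h
    exact Fin.ext (q.bypass_isPath.getVert_injOn (Nat.lt_succ_iff.1 i.2)
      (Nat.lt_succ_iff.1 i'.2) h)
  · intro i
    simpa using (graphOfFlip_adj.1 (q.bypass.adj_getVert_succ i.2)).2
  · simp
  · simp

/-- First moment bound for the existence of a vertex with many vertices within distance `k`. -/
lemma bitProb_large_ball_le {p M : ℝ} (h0 : 0 ≤ p) (h1 : p ≤ 1) (hn : 0 < n) (k : ℕ)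
    (hM : ∀ j ≤ 2 * k, (n * p) ^ j ≤ M) :
    bitProb p {f | ∃ z : Fin n, n ≤ 4 *
      {w | ∃ q : (graphOfFlip f).Walk w z, q.length ≤ k}.ncard} ≤
        16 * (2 * k + 1) * M / n := by
  classical
  let s : Finset (Σ j : ℕ, Fin (j + 1) → Fin n) :=
    (Finset.range (2 * k + 1)).sigma fun j => Finset.univ.filter fun x => Function.Injective x
  have hn' : (0 : ℝ) < n := by exact_mod_cast hn
  have hmark := mul_bitProb_le_sum h0 h1 s (fun y => chainPresent y.2)
    {f | ∃ z : Fin n, n ≤ 4 * {w | ∃ q : (graphOfFlip f).Walk w z, q.length ≤ k}.ncard}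
    ((n : ℝ) ^ 2 / 16) ?_
  · have hsum : ∑ y ∈ s, bitProb p (chainPresent y.2) ≤ (2 * k + 1) * (n * M) := by
      rw [Finset.sum_sigma]
      calc _ ≤ ∑ j ∈ Finset.range (2 * k + 1), n * M := by
            refine Finset.sum_le_sum fun j hj => ?_
            rw [Finset.sum_congr rfl fun x hx =>
              bitProb_chainPresent p (Finset.mem_filter.1 hx).2, Finset.sum_const, nsmul_eq_mul]
            have hcard : (((Finset.univ.filter fun x : Fin (j + 1) → Fin n =>
                Function.Injective x).card : ℕ) : ℝ) ≤ (n : ℝ) ^ (j + 1) := by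
              have := Finset.card_le_univ (Finset.univ.filter fun x : Fin (j + 1) → Fin n =>
                Function.Injective x)
              rw [Fintype.card_fun, Fintype.card_fin, Fintype.card_fin] at this
              exact_mod_cast this
            calc _ ≤ (n : ℝ) ^ (j + 1) * p ^ j := by gcongr
              _ = n * (n * p) ^ j := by ring
              _ ≤ n * M := by
                have := hM j (by have := Finset.mem_range.1 hj; omega)
                gcongr
        _ = _ := by simp
    rw [le_div_iff₀ hn']
    refine le_of_mul_le_mul_left (le_trans (le_of_eq ?_) (hmark.trans hsum) |>.trans
      (le_of_eq ?_)) (show (0 : ℝ) < n / 16 by positivity)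
    · ring
    · ring
  · rintro f ⟨z, hz⟩
    set B := {w | ∃ q : (graphOfFlip f).Walk w z, q.length ≤ k} with hB
    let t := s.filter fun y => f ∈ chainPresent y.2
    refine ⟨t, Finset.filter_subset _ _, ?_, fun y hy => (Finset.mem_filter.1 hy).2⟩
    have hBt : B.toFinset ×ˢ B.toFinset ⊆ t.image fun y => (y.2 0, y.2 (Fin.last y.1)) := by
      rintro ⟨a, b⟩ hab
      rw [Finset.mem_product, Set.mem_toFinset, Set.mem_toFinset] at hab
      obtain ⟨⟨qa, hqa⟩, ⟨qb, hqb⟩⟩ := hab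
      obtain ⟨j, hj, x, hx, hfx, rfl, rfl⟩ := exists_chain_of_walk (qa.append qb.reverse)
      rw [SimpleGraph.Walk.length_append, SimpleGraph.Walk.length_reverse] at hj
      refine Finset.mem_image.2 ⟨⟨j, x⟩, ?_, rfl⟩
      simp only [t, s, Finset.mem_filter, Finset.mem_sigma, Finset.mem_range, Finset.mem_univ,
        true_and]
      exact ⟨⟨by omega, hx⟩, hfx⟩
    have hcard := (Finset.card_le_card hBt).trans Finset.card_image_le
    rw [Finset.card_product, ← Set.ncard_eq_toFinset_card'] at hcard
    have hcard' : (B.ncard : ℝ) * B.ncard ≤ t.card := by exact_mod_cast hcard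
    have hz' : (n : ℝ) ≤ 4 * B.ncard := by exact_mod_cast hz
    nlinarith

lemma exists_large_ball_of_large_Sbelow {f : Sym2 (Fin n) → Bool} {u v : Fin n} (huv : u ≠ v)
    {k : ℕ} (h : n < 2 * (Sbelow (graphOfFlip f) u v (k + 1)).ncard) :
    ∃ z : Fin n, n ≤ 4 * {w | ∃ q : (graphOfFlip f).Walk w z, q.length ≤ k}.ncard := by
  have hsub : Sbelow (graphOfFlip f) u v (k + 1) ⊆
      {w | ∃ q : (graphOfFlip f).Walk w u, q.length ≤ k} ∪
        {w | ∃ q : (graphOfFlip f).Walk w v, q.length ≤ k} := by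
    intro w hw
    obtain ⟨j, hj, hne⟩ := (mem_Sbelow_iff _ huv _ w).1 hw
    obtain ⟨q, hq⟩ | ⟨q, hq⟩ := exists_walk_of_walkDisc_ne_zero _ u v j w hne
    · exact Or.inl ⟨q, by omega⟩
    · exact Or.inr ⟨q, by omega⟩
  have hcard := (Set.ncard_le_ncard hsub (Set.toFinite _)).trans (Set.ncard_union_le _ _)
  by_contra! hcon
  have := hcon u
  have := hcon v
  omega

end Neighbourhoods

/-- The probability that some stably equivalent pair keeps discovering vertices for `k` steps. -/
lemma bitProb_exists_long_discovery_le {n : ℕ} {p c M : ℝ} (h0 : 0 ≤ p) (h1 : p ≤ 1)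
    (hc0 : 0 ≤ c) (hn : 0 < n) (k : ℕ) (hM : ∀ j ≤ 2 * k, (n * p) ^ j ≤ M)
    (hc : ∀ m ≤ n, n ≤ 2 * m → (1 - p) ^ m ≤ c ∧ 1 - (1 - p) ^ m ≤ c) :
    bitProb p {f | ∃ u v : Fin n, u ≠ v ∧ crStableTrivial (graphOfFlip f) u v ∧
      ∀ i ≤ k, (Sat (graphOfFlip f) u v i).Nonempty} ≤
        16 * (2 * k + 1) * M / n + n ^ 2 * c ^ k := by
  classical
  let s : Finset (Fin n × Fin n) := Finset.univ.filter fun q => q.1 ≠ q.2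
  have hsub : {f | ∃ u v : Fin n, u ≠ v ∧ crStableTrivial (graphOfFlip f) u v ∧
      ∀ i ≤ k, (Sat (graphOfFlip f) u v i).Nonempty} ⊆
      {f | ∃ z : Fin n, n ≤ 4 * {w | ∃ q : (graphOfFlip f).Walk w z, q.length ≤ k}.ncard} ∪
        ⋃ q ∈ s, survives q.1 q.2 k := by
    rintro f ⟨u, v, huv, hst, hS⟩
    by_cases hlarge : n < 2 * (Sbelow (graphOfFlip f) u v (k + 1)).ncard
    · exact Or.inl (exists_large_ball_of_large_Sbelow huv hlarge)
    · refine Or.inr (Set.mem_biUnion (x := (u, v)) (by simpa [s] using huv) ?_)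
      exact ⟨fun j hj => ⟨hS j hj, sum_walkDisc_eq_zero hst j⟩, not_lt.1 hlarge⟩
  refine (bitProb_mono h0 h1 hsub).trans ((bitProb_union_le h0 h1 _ _).trans
    (add_le_add (bitProb_large_ball_le h0 h1 hn k hM) ?_))
  refine (bitProb_biUnion_le h0 h1 s _).trans ((Finset.sum_le_sum fun q hq =>
    bitProb_survives_le_pow h0 h1 hc0 (Finset.mem_filter.1 hq).2 hc k).trans ?_)
  rw [Finset.sum_const, nsmul_eq_mul]
  gcongr
  have := Finset.card_le_univ s
  rw [Fintype.card_prod, Fintype.card_fin] at this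
  rw [sq]
  exact_mod_cast this

lemma one_sub_pow_bounds {n m : ℕ} {p : ℝ} (h1 : p ≤ 1) (hn : 2 ≤ n) (hlb : 0.9 / n ≤ p)
    (hub : p ≤ 1.1 / n) (hexp : 0.3 ≤ (1 + (-1.1) / (n : ℝ)) ^ n) (hmn : m ≤ n)
    (hnm : n ≤ 2 * m) : (1 - p) ^ m ≤ 0.7 ∧ 1 - (1 - p) ^ m ≤ 0.7 := by
  have hn' : (0 : ℝ) < n := by exact_mod_cast (by omega : 0 < n)
  have h0 : 0 ≤ p := le_trans (by positivity) hlb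
  have hnm' : (n : ℝ) ≤ 2 * m := by exact_mod_cast hnm
  constructor
  · have hpm : 0.45 ≤ m * p := by
      have := (div_le_iff₀ hn').1 hlb
      nlinarith
    calc (1 - p) ^ m ≤ Real.exp (-p) ^ m := by
          have := Real.add_one_le_exp (-p)
          exact pow_le_pow_left₀ (by linarith) (by linarith) m
      _ = Real.exp (-(m * p)) := by rw [← Real.exp_nat_mul]; congr 1; ring
      _ ≤ Real.exp (-0.45) := Real.exp_le_exp.2 (by linarith)
      _ ≤ 0.7 := by
        rw [Real.exp_neg, inv_le_comm₀ (Real.exp_pos _) (by norm_num)]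
        have := Real.add_one_le_exp (0.45 : ℝ)
        norm_num at this ⊢
        linarith
  · have : (0.3 : ℝ) ≤ (1 - p) ^ m := by
      have hb : 0 ≤ 1 + (-1.1) / (n : ℝ) := by
        have : (1.1 : ℝ) / n ≤ 1 := by
          rw [div_le_one hn']
          have : (2 : ℝ) ≤ n := by exact_mod_cast hn
          linarith
        rw [neg_div]
        linarith
      calc (0.3 : ℝ) ≤ (1 + (-1.1) / (n : ℝ)) ^ n := hexp
        _ ≤ (1 - p) ^ n := by
          refine pow_le_pow_left₀ hb ?_ n
          rw [neg_div]
          linarith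
        _ ≤ (1 - p) ^ m := pow_le_pow_of_le_one (by linarith) (by linarith) hmn
    linarith

lemma mul_pow_le_three {n j : ℕ} {p : ℝ} (h0 : 0 ≤ p) (hn : 0 < n) (hL : 2 ≤ Real.log n)
    (hub : p ≤ (1 + ((Real.log n) ^ 40)⁻¹) / n) (hj : (j : ℝ) ≤ 20 * Real.log n) :
    (n * p) ^ j ≤ 3 := by
  have hn' : (0 : ℝ) < n := by exact_mod_cast hn
  set L := Real.log n
  have hL40 : 20 * L ≤ L ^ 40 := by
    have : (2 : ℝ) ^ 39 ≤ L ^ 39 := pow_le_pow_left₀ (by norm_num) hL 39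
    rw [pow_succ]
    gcongr
    linarith
  have hnp : n * p ≤ Real.exp ((L ^ 40)⁻¹) := by
    have := (le_div_iff₀ hn').1 hub
    linarith [Real.add_one_le_exp ((L ^ 40)⁻¹)]
  calc (n * p) ^ j ≤ Real.exp ((L ^ 40)⁻¹) ^ j := pow_le_pow_left₀ (by positivity) hnp j
    _ = Real.exp (j * (L ^ 40)⁻¹) := by rw [← Real.exp_nat_mul]
    _ ≤ Real.exp 1 := by
      refine Real.exp_le_exp.2 ?_
      rw [← div_eq_mul_inv, div_le_one (by positivity)]
      linarith
    _ ≤ 3 := Real.exp_one_lt_d9.le.trans (by norm_num)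

lemma sq_mul_pow_floor_le {n : ℕ} (hn : 0 < n) :
    (n : ℝ) ^ 2 * 0.7 ^ ⌊10 * Real.log n⌋₊ ≤ 2 / n := by
  have hn' : (0 : ℝ) < n := by exact_mod_cast hn
  have hk := (Nat.sub_one_lt_floor (10 * Real.log n)).le
  set k := ⌊10 * Real.log n⌋₊
  have h7 : (0.7 : ℝ) ^ k ≤ 2 / n ^ 3 := by
    calc (0.7 : ℝ) ^ k ≤ Real.exp (-0.3) ^ k := by
          have := Real.add_one_le_exp (-0.3 : ℝ)
          exact pow_le_pow_left₀ (by norm_num) (by linarith) k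
      _ = Real.exp (-0.3 * k) := by rw [← Real.exp_nat_mul]; congr 1; ring
      _ ≤ Real.exp (0.3 - (3 : ℕ) * Real.log n) := by
        refine Real.exp_le_exp.2 ?_
        push_cast
        linarith
      _ = Real.exp 0.3 / n ^ 3 := by rw [Real.exp_sub, Real.exp_nat_mul, Real.exp_log hn']
      _ ≤ 2 / n ^ 3 := by
        gcongr
        rw [← Real.le_log_iff_exp_le (by norm_num)]
        linarith [Real.log_two_gt_d9]
  calc (n : ℝ) ^ 2 * 0.7 ^ k ≤ (n : ℝ) ^ 2 * (2 / (n : ℝ) ^ 3) := by gcongr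
    _ = 2 / (n : ℝ) := by field_simp

lemma tendsto_log_div_natCast : Tendsto (fun n : ℕ => Real.log n / n) atTop (nhds 0) :=
  (Real.isLittleO_log_id_atTop.tendsto_div_nhds_zero).comp tendsto_natCast_atTop_atTop

/-- Lemma 6.2.
For `p = p_n` with (eventually) `0.9/n ≤ p ≤ (1+(log n)^{-40})/n`, whp `G ∼ G(n,p)` satisfies:
for every pair of distinct vertices receiving the same colour in `R*σ`, there is some
`i ≤ 10 log n` with `S^i_G({u,v}) = ∅`. -/
theorem stmt17 (p : ℕ → ℝ) (hp0 : ∀ n, 0 ≤ p n) (hp1 : ∀ n, p n ≤ 1)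
    (hlb : ∀ᶠ n : ℕ in atTop, 0.9 / n ≤ p n)
    (hub : ∀ᶠ n : ℕ in atTop, p n ≤ (1 + ((Real.log n) ^ 40)⁻¹) / n) :
    Tendsto (fun n : ℕ =>
      erdosRenyiMeasure n (p n)
        {f | ∀ u v : Fin n, u ≠ v → crStableTrivial (graphOfFlip f) u v →
          ∃ i : ℕ, (i : ℝ) ≤ 10 * Real.log n ∧ Sat (graphOfFlip f) u v i = ∅})
      atTop (nhds 1) := by
  have hlog : Tendsto (fun n : ℕ => Real.log n) atTop atTop :=
    Real.tendsto_log_atTop.comp tendsto_natCast_atTop_atTop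
  have hexp : ∀ᶠ n : ℕ in atTop, (0.3 : ℝ) ≤ (1 + (-1.1) / (n : ℝ)) ^ n := by
    refine (Real.tendsto_one_add_div_pow_exp (-1.1)).eventually_const_le ?_
    rw [show (-1.1 : ℝ) = -0.1 - 1 by norm_num, Real.exp_sub, lt_div_iff₀ (Real.exp_pos 1)]
    linarith [Real.add_one_le_exp (-0.1 : ℝ), Real.exp_one_lt_d9]
  let bad : ∀ n : ℕ, Set (Sym2 (Fin n) → Bool) := fun n =>
    {f | ∃ u v : Fin n, u ≠ v ∧ crStableTrivial (graphOfFlip f) u v ∧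
      ∀ i ≤ ⌊10 * Real.log n⌋₊, (Sat (graphOfFlip f) u v i).Nonempty}
  have hgood : ∀ n : ℕ, erdosRenyiMeasure n (p n)
      {f | ∀ u v : Fin n, u ≠ v → crStableTrivial (graphOfFlip f) u v →
        ∃ i : ℕ, (i : ℝ) ≤ 10 * Real.log n ∧ Sat (graphOfFlip f) u v i = ∅} =
      ENNReal.ofReal (1 - bitProb (p n) (bad n)) := by
    intro n
    rw [erdosRenyiMeasure, bernoulliProduct_apply (hp0 n) (hp1 n),
      ← bitProb_univ (ι := Sym2 (Fin n)) (p n),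
      ← bitProb_inter_add_diff (p n) Set.univ (bad n), Set.univ_inter, add_sub_cancel_left]
    congr 2
    ext f
    have hL : 0 ≤ 10 * Real.log n := by positivity
    simp only [bad, Set.mem_ofPred_eq, Set.mem_sdiff, Set.mem_univ, true_and,
      ← Nat.le_floor_iff hL]
    push Not
    rfl
  have hbad : Tendsto (fun n => bitProb (p n) (bad n)) atTop (nhds 0) := by
    have hlim : Tendsto (fun n : ℕ => 960 * (Real.log n / n) + 50 / (n : ℝ)) atTop (nhds 0) := by
      simpa using (tendsto_log_div_natCast.const_mul 960).add
        (tendsto_const_div_atTop_nhds_zero_nat 50)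
    refine squeeze_zero' (Eventually.of_forall fun n => bitProb_nonneg (hp0 n) (hp1 n) _) ?_ hlim
    filter_upwards [hlb, hub, hexp, hlog.eventually_ge_atTop 2, eventually_ge_atTop 2]
      with n hl hu he hL hn2
    have hn : 0 < n := by omega
    have hn' : (0 : ℝ) < n := by exact_mod_cast hn
    have hkL : (⌊10 * Real.log n⌋₊ : ℝ) ≤ 10 * Real.log n := Nat.floor_le (by positivity)
    have hu' : p n ≤ 1.1 / n := by
      refine hu.trans ?_
      gcongr
      have : (10 : ℝ) ≤ Real.log n ^ 40 :=
        le_trans (by norm_num) (pow_le_pow_left₀ (by norm_num) hL 40)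
      have := inv_anti₀ (by norm_num) this
      norm_num at this ⊢
      linarith
    refine (bitProb_exists_long_discovery_le (hp0 n) (hp1 n) (c := 0.7) (M := 3) (by norm_num)
      hn _ (fun j hj => mul_pow_le_three (hp0 n) hn hL hu ?_)
      fun m hmn hnm => one_sub_pow_bounds (hp1 n) hn2 hl hu' he hmn hnm).trans ?_
    · have : (j : ℝ) ≤ 2 * ⌊10 * Real.log n⌋₊ := by exact_mod_cast hj
      linarith
    · have h2 := sq_mul_pow_floor_le hn
      have h3 : 16 * (2 * (⌊10 * Real.log n⌋₊ : ℝ) + 1) * 3 / n ≤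
          16 * (2 * (10 * Real.log n) + 1) * 3 / n := by gcongr
      calc _ ≤ 16 * (2 * (10 * Real.log n) + 1) * 3 / n + 2 / n := add_le_add h3 h2
        _ = _ := by field_simp; ring
  simp only [hgood]
  simpa using ENNReal.tendsto_ofReal (hbad.const_sub 1)
end

section
/- Let G ∼ G(n,p) for some p = p_n satisfying p ≤ (1+(log n)^{-2})/n. Then with high probability G does not contain any connected subgraph with at most 200·log n vertices and at least two cycles (equivalently, no connected subgraph on at most 200·log n vertices whose number of edges exceeds its number of vertices). -/
open MeasureTheory Filter

/-- The set of edges joining consecutive entries of a list. -/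
def pathEdges {V : Type*} [DecidableEq V] : List V → Finset (Sym2 V)
  | [] => ∅
  | [_] => ∅
  | x :: y :: l => insert s(x, y) (pathEdges (y :: l))

open Classical in
/-- The edges of `G` with both ends in `S`. -/
noncomputable def edgesIn {V : Type*} (G : SimpleGraph V) (S : Finset V) : Finset (Sym2 V) :=
  S.sym2.filter (· ∈ G.edgeSet)

section

variable {V : Type*} {G : SimpleGraph V}

theorem mem_edgesIn {S : Finset V} {e : Sym2 V} :
    e ∈ edgesIn G S ↔ (∀ x ∈ e, x ∈ S) ∧ e ∈ G.edgeSet := by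
  simp [edgesIn, Finset.mem_sym2_iff]

theorem mk_mem_edgesIn {S : Finset V} {a b : V} :
    s(a, b) ∈ edgesIn G S ↔ (a ∈ S ∧ b ∈ S) ∧ G.Adj a b := by
  simp [mem_edgesIn]

/-- A cyclically ordered path can be rotated so that it starts at any of its vertices. -/
theorem exists_rotated_path {l : List V} (hnd : l.Nodup) (hl : l.IsChain G.Adj)
    (hclosed : ∀ a ∈ l.getLast?, ∀ b ∈ l.head?, G.Adj a b) {v : V} (hv : v ∈ l) :
    ∃ t, (v :: t).Perm l ∧ (v :: t).IsChain G.Adj := by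
  obtain ⟨l₁, l₂, rfl⟩ := List.append_of_mem hv
  refine ⟨l₂ ++ l₁, by simpa using List.perm_append_comm (l₁ := v :: l₂) (l₂ := l₁), ?_⟩
  rw [← List.cons_append]
  rw [List.isChain_append] at hl ⊢
  refine ⟨hl.2.1, hl.1, fun a ha b hb => hclosed a ?_ b ?_⟩
  · rw [List.getLast?_append]
    simp only [Option.mem_def] at ha ⊢
    simp [ha]
  · rw [List.head?_append]
    simp only [Option.mem_def] at hb ⊢
    simp [hb]

variable [DecidableEq V]

theorem mem_pathEdges {e : Sym2 V} {l : List V} :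
    e ∈ pathEdges l ↔ ∃ a b, e = s(a, b) ∧ [a, b] <:+: l := by
  induction l using pathEdges.induct with
  | case1 => simp [pathEdges]
  | case2 x => simp [pathEdges, List.infix_cons_iff]
  | case3 x y l ih =>
    rw [pathEdges, Finset.mem_insert, ih]
    constructor
    · rintro (rfl | ⟨a, b, rfl, h⟩)
      · exact ⟨x, y, rfl, List.infix_cons_iff.2 (Or.inl (by simp))⟩
      · exact ⟨a, b, rfl, List.infix_cons_iff.2 (Or.inr h)⟩
    · rintro ⟨a, b, rfl, h⟩
      rcases List.infix_cons_iff.1 h with h | h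
      · simp only [List.cons_prefix_cons, List.nil_prefix, and_true] at h
        exact Or.inl (by rw [h.1, h.2])
      · exact Or.inr ⟨a, b, rfl, h⟩

theorem pathEdges_reverse (l : List V) : pathEdges l.reverse = pathEdges l := by
  have key : ∀ l : List V, pathEdges l.reverse ⊆ pathEdges l := by
    intro l e he
    obtain ⟨a, b, rfl, h⟩ := mem_pathEdges.1 he
    refine mem_pathEdges.2 ⟨b, a, Sym2.eq_swap, ?_⟩
    rw [← List.reverse_infix]
    simpa using h
  refine (key l).antisymm ?_
  simpa using key l.reverse

theorem mem_of_mem_pathEdges {l : List V} {e : Sym2 V} (he : e ∈ pathEdges l) {v : V}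
    (hv : v ∈ e) : v ∈ l := by
  obtain ⟨a, b, rfl, h⟩ := mem_pathEdges.1 he
  exact h.subset (by simpa using hv)

theorem head?_eq_of_mem_pathEdges {x z : V} {t : List V} (hnd : (x :: t).Nodup)
    (h : s(x, z) ∈ pathEdges (x :: t)) : t.head? = some z := by
  cases t with
  | nil => simp [pathEdges] at h
  | cons y t =>
    rw [pathEdges, Finset.mem_insert] at h
    rcases h with h | h
    · simpa using (Sym2.congr_right.1 h).symm
    · exact absurd (mem_of_mem_pathEdges h (Sym2.mem_mk_left x z)) (List.nodup_cons.1 hnd).1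

theorem card_pathEdges_add_one {l : List V} (hnd : l.Nodup) (hl : l ≠ []) :
    (pathEdges l).card + 1 = l.length := by
  induction l using pathEdges.induct with
  | case1 => exact absurd rfl hl
  | case2 x => simp [pathEdges]
  | case3 x y l ih =>
    rw [pathEdges, Finset.card_insert_of_notMem, ih (List.nodup_cons.1 hnd).2 (by simp)]
    · simp
    · exact fun h => (List.nodup_cons.1 hnd).1 (mem_of_mem_pathEdges h (Sym2.mem_mk_left x y))

theorem pathEdges_subset_edgesIn {l : List V} (hl : l.IsChain G.Adj) :
    pathEdges l ⊆ edgesIn G l.toFinset := by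
  intro e he
  obtain ⟨a, b, rfl, h⟩ := mem_pathEdges.1 he
  refine mk_mem_edgesIn.2 ⟨⟨?_, ?_⟩, ?_⟩
  · exact List.mem_toFinset.2 (h.subset (by simp))
  · exact List.mem_toFinset.2 (h.subset (by simp))
  · simpa using hl.infix h

theorem edgesIn_subset_insert {S : Finset V} {v y : V}
    (h : ∀ z ∈ S, G.Adj v z → z = y) :
    edgesIn G S ⊆ insert s(v, y) (edgesIn G (S.erase v)) := by
  intro e
  induction e with
  | _ a b =>
    rw [mk_mem_edgesIn, Finset.mem_insert, mk_mem_edgesIn]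
    rintro ⟨⟨ha, hb⟩, hab⟩
    by_cases hav : a = v
    · subst hav
      exact Or.inl (by rw [h b hb hab])
    by_cases hbv : b = v
    · subst hbv
      exact Or.inl (by rw [h a ha hab.symm, Sym2.eq_swap])
    exact Or.inr ⟨⟨Finset.mem_erase.2 ⟨hav, ha⟩, Finset.mem_erase.2 ⟨hbv, hb⟩⟩, hab⟩

theorem edgesIn_subset_union {S T : Finset V}
    (h : ∀ v ∈ T, ∀ w ∈ S, G.Adj v w → w ∈ T) :
    edgesIn G S ⊆ edgesIn G T ∪ edgesIn G (S \ T) := by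
  intro e
  induction e with
  | _ a b =>
    rw [mk_mem_edgesIn, Finset.mem_union, mk_mem_edgesIn, mk_mem_edgesIn]
    rintro ⟨⟨ha, hb⟩, hab⟩
    by_cases haT : a ∈ T
    · exact Or.inl ⟨⟨haT, h a haT b hb hab⟩, hab⟩
    · have hbT : b ∉ T := fun hbT => haT (h b hbT a ha hab.symm)
      exact Or.inr ⟨⟨Finset.mem_sdiff.2 ⟨ha, haT⟩, Finset.mem_sdiff.2 ⟨hb, hbT⟩⟩, hab⟩

/-- If the vertex set `S` spans more than `#S` edges, then some path within `S` has a vertex set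
spanning more edges than vertices. -/
theorem exists_path_card_lt_card_edgesIn (S : Finset V) (hS : S.card + 1 ≤ (edgesIn G S).card) :
    ∃ l : List V, l.Nodup ∧ l.IsChain G.Adj ∧ l.toFinset ⊆ S ∧
      l.length + 1 ≤ (edgesIn G l.toFinset).card := by
  induction S using Finset.strongInduction with
  | _ S ih =>
  by_contra hno
  have hmin : ∀ T, T ⊂ S → (edgesIn G T).card ≤ T.card := by
    intro T hT
    by_contra hlt
    obtain ⟨l, h₁, h₂, h₃, h₄⟩ := ih T hT (by omega)
    exact hno ⟨l, h₁, h₂, h₃.trans hT.subset, h₄⟩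
  have hdeg : ∀ v ∈ S, ∀ y, ∃ z ∈ S, G.Adj v z ∧ z ≠ y := by
    intro v hv y
    by_contra hcon
    push Not at hcon
    have h₁ := Finset.card_le_card (edgesIn_subset_insert hcon)
    have h₂ := Finset.card_insert_le s(v, y) (edgesIn G (S.erase v))
    have h₃ := hmin _ (Finset.erase_ssubset hv)
    have h₄ := Finset.card_erase_add_one hv
    omega
  let good : Set (List V) := {l | l.Nodup ∧ l.IsChain G.Adj ∧ l.toFinset ⊆ S}
  have hlen : ∀ l ∈ good, l.length ≤ S.card := fun l hl => by
    rw [← List.toFinset_card_of_nodup hl.1]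
    exact Finset.card_le_card hl.2.2
  obtain ⟨l, hl, hmax⟩ : ∃ l ∈ good, ∀ l' ∈ good, l'.length ≤ l.length := by
    obtain ⟨l, hl, h⟩ := (measure fun l : List V => S.card - l.length).wf.has_min good
      ⟨[], by simp [good]⟩
    refine ⟨l, hl, fun l' hl' => ?_⟩
    have h₁ : ¬ (S.card - l'.length < S.card - l.length) := h l' hl'
    have h₂ := hlen l' hl'
    omega
  have hmem : ∀ {x t}, (x :: t) ∈ good → (x :: t).length = l.length →
      ∀ z ∈ S, G.Adj x z → z ∈ x :: t := by
    intro x t hg hlt z hz hxz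
    by_contra hzt
    have := hmax (z :: x :: t) ⟨List.nodup_cons.2 ⟨hzt, hg.1⟩,
      List.isChain_cons_cons.2 ⟨hxz.symm, hg.2.1⟩, by
        rw [List.toFinset_cons]
        exact Finset.insert_subset hz hg.2.2⟩
    simp only [List.length_cons] at this hlt
    omega
  have hchord : ∀ {x t}, (x :: t) ∈ good → (x :: t).length = l.length →
      ∃ z ∈ x :: t, G.Adj x z ∧ s(x, z) ∉ pathEdges (x :: t) := by
    intro x t hg hlt
    obtain ⟨z, hz, hxz, hne⟩ := hdeg x (hg.2.2 (by simp)) (t.head?.getD x)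
    refine ⟨z, hmem hg hlt z hz hxz, hxz, fun h => hne ?_⟩
    simp [head?_eq_of_mem_pathEdges hg.1 h]
  have hSne : S.Nonempty := by
    rw [Finset.nonempty_iff_ne_empty]
    rintro rfl
    simp [edgesIn] at hS
  have hlne : l ≠ [] := by
    rintro rfl
    obtain ⟨v, hv⟩ := hSne
    have := hmax [v] (by simp [good, hv])
    simp at this
  have hcardT := List.toFinset_card_of_nodup hl.1
  have hTS : l.toFinset ⊂ S := by
    refine hl.2.2.ssubset_of_ne fun h => hno ⟨l, hl.1, hl.2.1, hl.2.2, ?_⟩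
    rw [← hcardT, h]
    exact hS
  have heT := hmin _ hTS
  have hrev : l.reverse ∈ good := by
    refine ⟨List.nodup_reverse.2 hl.1, ?_, by simpa using hl.2.2⟩
    rw [List.isChain_reverse]
    exact hl.2.1.imp fun _ _ h => h.symm
  have hclosed : ∀ a ∈ l.getLast?, ∀ b ∈ l.head?, G.Adj a b := by
    intro y hy x hx
    obtain ⟨t, rfl⟩ : ∃ t, l = x :: t := by
      cases l with
      | nil => simp at hx
      | cons a t => exact ⟨t, by simp at hx; rw [hx]⟩
    obtain ⟨t', ht'⟩ : ∃ t', (x :: t).reverse = y :: t' := by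
      rw [← List.head?_reverse] at hy
      cases h : (x :: t).reverse with
      | nil => simp at h
      | cons a t' => exact ⟨t', by rw [h] at hy; simp at hy; rw [hy]⟩
    obtain ⟨z, hz, hxz, hzp⟩ := hchord hl rfl
    obtain ⟨w, hw, hyw, hwp⟩ := hchord (ht' ▸ hrev) (by rw [← ht', List.length_reverse])
    rw [← ht'] at hw hwp
    rw [pathEdges_reverse] at hwp
    rw [List.mem_reverse] at hw
    have hyl : y ∈ x :: t := List.mem_of_getLast? hy
    have heq : s(x, z) = s(y, w) := by
      by_contra hne
      have hsub : insert s(x, z) (insert s(y, w) (pathEdges (x :: t))) ⊆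
          edgesIn G (x :: t).toFinset := by
        refine Finset.insert_subset ?_ (Finset.insert_subset ?_ (pathEdges_subset_edgesIn hl.2.1))
        · exact mk_mem_edgesIn.2 ⟨⟨by simp, List.mem_toFinset.2 hz⟩, hxz⟩
        · exact mk_mem_edgesIn.2 ⟨⟨List.mem_toFinset.2 hyl, List.mem_toFinset.2 hw⟩, hyw⟩
      have h₁ := Finset.card_le_card hsub
      rw [Finset.card_insert_of_notMem (by simp [hne, hzp]), Finset.card_insert_of_notMem hwp] at h₁
      have h₂ := card_pathEdges_add_one hl.1 hlne
      omega
    rcases Sym2.eq_iff.1 heq with ⟨hxy, -⟩ | ⟨-, hzy⟩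
    · exfalso
      cases t with
      | nil =>
        rw [List.mem_singleton.1 hz] at hxz
        exact hxz.ne rfl
      | cons a t =>
        rw [List.getLast?_cons_cons] at hy
        exact (List.nodup_cons.1 hl.1).1 (hxy ▸ List.mem_of_getLast? hy)
    · exact hzy ▸ hxz.symm
  have hcut : ∀ v ∈ l.toFinset, ∀ w ∈ S, G.Adj v w → w ∈ l.toFinset := by
    intro v hv w hw hvw
    obtain ⟨t, hperm, hchain⟩ :=
      exists_rotated_path hl.1 hl.2.1 hclosed (List.mem_toFinset.1 hv)
    refine List.mem_toFinset.2 (hperm.subset (hmem ⟨hperm.nodup_iff.2 hl.1, hchain, ?_⟩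
      hperm.length_eq w hw hvw))
    rw [List.toFinset_eq_of_perm _ _ hperm]
    exact hl.2.2
  have hdiff : S \ l.toFinset ⊂ S :=
    Finset.sdiff_ssubset hl.2.2 (by simpa [Finset.nonempty_iff_ne_empty] using hlne)
  have h₁ := Finset.card_le_card (edgesIn_subset_union hcut)
  have h₂ := Finset.card_union_le (edgesIn G l.toFinset) (edgesIn G (S \ l.toFinset))
  have h₃ := hmin _ hdiff
  have h₄ := Finset.card_sdiff_add_card_eq_card hl.2.2
  omega

theorem card_adj_le_two_mul_card_edgesIn [Fintype V] (S : Finset V) :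
    Nat.card {e : V × V // e.1 ∈ S ∧ e.2 ∈ S ∧ G.Adj e.1 e.2} ≤ 2 * (edgesIn G S).card := by
  classical
  rw [Nat.card_eq_fintype_card, Fintype.card_subtype]
  refine (Finset.card_le_mul_card_image (f := fun e : V × V => s(e.1, e.2)) _ 2 ?_).trans ?_
  · intro b _
    induction b with
    | _ x y =>
      refine (Finset.card_le_card (t := {(x, y), (y, x)}) ?_).trans Finset.card_le_two
      rintro ⟨a, b⟩ h
      have h := Sym2.eq_iff.1 (Finset.mem_filter.1 h).2
      simpa using h
  · refine Nat.mul_le_mul_left 2 (Finset.card_le_card ?_)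
    intro e he
    obtain ⟨⟨a, b⟩, h, rfl⟩ := Finset.mem_image.1 he
    have h := (Finset.mem_filter.1 h).2
    exact mk_mem_edgesIn.2 ⟨⟨h.1, h.2.1⟩, h.2.2⟩

/-- The vertex sequence `v` together with the chords joining `v a` to `v b` and `v c` to `v d`. -/
def pathWithChords {k : ℕ} (v : Fin k → V) (a b c d : Fin k) : Finset (Sym2 V) :=
  insert s(v a, v b) (insert s(v c, v d) (pathEdges (List.ofFn v)))

/-- If `S` spans more than `#S` edges, then `G` contains a path on at most `#S` vertices together
with two further edges among the vertices of that path. -/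
theorem exists_pathWithChords (S : Finset V) (hS : S.card + 1 ≤ (edgesIn G S).card) :
    ∃ k ≤ S.card, ∃ (v : Fin k → V) (a b c d : Fin k),
      (pathWithChords v a b c d).card = k + 1 ∧
      ∀ e ∈ pathWithChords v a b c d, e ∈ G.edgeSet := by
  obtain ⟨l, hnd, hch, hlS, hcard⟩ := exists_path_card_lt_card_edgesIn S hS
  have hlne : l ≠ [] := by
    rintro rfl
    simp [edgesIn] at hcard
  have hsub := pathEdges_subset_edgesIn hch
  have hpc := card_pathEdges_add_one hnd hlne
  have hone : 1 < (edgesIn G l.toFinset \ pathEdges l).card := by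
    rw [Finset.card_sdiff_of_subset hsub]
    omega
  obtain ⟨e, he, e', he', hne⟩ := Finset.one_lt_card.1 hone
  rw [Finset.mem_sdiff] at he he'
  have hind : ∀ e ∈ edgesIn G l.toFinset, ∃ a b : Fin l.length, e = s(l.get a, l.get b) := by
    intro e
    induction e with
    | _ x y =>
      intro h
      obtain ⟨⟨hx, hy⟩, -⟩ := mk_mem_edgesIn.1 h
      obtain ⟨a, ha⟩ := List.mem_iff_get.1 (List.mem_toFinset.1 hx)
      obtain ⟨b, hb⟩ := List.mem_iff_get.1 (List.mem_toFinset.1 hy)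
      exact ⟨a, b, by rw [ha, hb]⟩
  obtain ⟨a, b, hab⟩ := hind e he.1
  obtain ⟨c, d, hcd⟩ := hind e' he'.1
  have hP : pathWithChords l.get a b c d = insert e (insert e' (pathEdges l)) := by
    rw [pathWithChords, List.ofFn_get, hab, hcd]
  refine ⟨l.length, ?_, l.get, a, b, c, d, ?_, fun f hf => ?_⟩
  · rw [← List.toFinset_card_of_nodup hnd]
    exact Finset.card_le_card hlS
  · rw [hP, Finset.card_insert_of_notMem (by simp [hne, he.2]),
      Finset.card_insert_of_notMem he'.2]
    omega
  · rw [hP] at hf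
    have : f ∈ edgesIn G l.toFinset := by
      rcases Finset.mem_insert.1 hf with rfl | hf
      · exact he.1
      rcases Finset.mem_insert.1 hf with rfl | hf
      · exact he'.1
      · exact hsub hf
    exact (mem_edgesIn.1 this).2

end

/-- Under a product of Bernoulli measures with common parameter `p`, a prescribed set `E` of
coordinates is entirely successful with probability `p ^ #E`. -/
theorem bernoulliProduct_forall_mem_eq_true {ι : Type*} [Fintype ι] [DecidableEq ι] {p : ℝ}
    (h0 : 0 ≤ p) (h1 : p ≤ 1) (E : Finset ι) :
    bernoulliProduct ι (fun _ => p) {f | ∀ i ∈ E, f i = true} = ENNReal.ofReal p ^ E.card := by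
  classical
  have key : ∀ f : ι → Bool,
      (∏ i : ι, if f i then ENNReal.ofReal p else ENNReal.ofReal (1 - p)) *
        ({f : ι → Bool | ∀ i ∈ E, f i = true}.indicator 1 f) =
      ∏ i : ι, (if f i then ENNReal.ofReal p
        else if i ∈ E then 0 else ENNReal.ofReal (1 - p)) := by
    intro f
    by_cases hf : ∀ i ∈ E, f i = true
    · rw [Set.indicator_of_mem (by exact hf)]
      simp only [Pi.one_apply, mul_one]
      refine Finset.prod_congr rfl fun i _ => ?_
      by_cases hi : i ∈ E <;> simp [hi, hf]
    · rw [Set.indicator_of_notMem (by exact hf), mul_zero]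
      push Not at hf
      obtain ⟨i, hi, hfi⟩ := hf
      exact (Finset.prod_eq_zero (Finset.mem_univ i) (by simp [hi, hfi])).symm
  have hsum : ∀ i : ι, (∑ b : Bool, if b then ENNReal.ofReal p
      else if i ∈ E then 0 else ENNReal.ofReal (1 - p)) =
      if i ∈ E then ENNReal.ofReal p else 1 := by
    intro i
    by_cases hi : i ∈ E
    · simp [hi]
    · simp only [Fintype.sum_bool, hi, if_true, if_false]
      rw [if_neg (by simp), ← ENNReal.ofReal_add h0 (by linarith)]
      simp
  rw [bernoulliProduct, Measure.finsetSum_apply]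
  simp only [Measure.smul_apply, smul_eq_mul]
  rw [Finset.sum_congr rfl fun f _ => by
    rw [Measure.dirac_apply' f (Set.toFinite _).measurableSet, key f]]
  have hprod := Finset.prod_univ_sum (fun _ : ι => (Finset.univ : Finset Bool))
    (fun i b => if b then ENNReal.ofReal p else if i ∈ E then 0 else ENNReal.ofReal (1 - p))
  rw [Fintype.piFinset_univ] at hprod
  rw [← hprod, Finset.prod_congr rfl fun i _ => hsum i]
  simp [Finset.prod_ite_mem]

theorem isProbabilityMeasure_bernoulliProduct {ι : Type*} [Fintype ι] [DecidableEq ι] {p : ℝ}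
    (h0 : 0 ≤ p) (h1 : p ≤ 1) : IsProbabilityMeasure (bernoulliProduct ι fun _ => p) :=
  ⟨by simpa using bernoulliProduct_forall_mem_eq_true h0 h1 (∅ : Finset ι)⟩

theorem mem_edgeSet_graphOfFlip {n : ℕ} {f : Sym2 (Fin n) → Bool} {e : Sym2 (Fin n)}
    (h : e ∈ (graphOfFlip f).edgeSet) : f e = true := by
  induction e with
  | _ a b =>
    rw [SimpleGraph.mem_edgeSet, graphOfFlip, SimpleGraph.fromRel_adj] at h
    rcases h.2 with h | h
    · exact h
    · rwa [Sym2.eq_swap]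

/-- The event that the edges of some path on at most `K` vertices together with two chords are all
present in the random graph. -/
def pathWithChordsEvent (n K : ℕ) : Set (Sym2 (Fin n) → Bool) :=
  ⋃ k ∈ Finset.range (K + 1), ⋃ q : (Fin k → Fin n) × Fin k × Fin k × Fin k × Fin k,
    {f | (pathWithChords q.1 q.2.1 q.2.2.1 q.2.2.2.1 q.2.2.2.2).card = k + 1 ∧
      ∀ e ∈ pathWithChords q.1 q.2.1 q.2.2.1 q.2.2.2.1 q.2.2.2.2, f e = true}

theorem erdosRenyiMeasure_pathWithChordsEvent_le {p : ℝ} (h0 : 0 ≤ p) (h1 : p ≤ 1) (n K : ℕ) :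
    erdosRenyiMeasure n p (pathWithChordsEvent n K) ≤
      ENNReal.ofReal (∑ k ∈ Finset.range (K + 1), (n : ℝ) ^ k * (k : ℝ) ^ 4 * p ^ (k + 1)) := by
  rw [ENNReal.ofReal_sum_of_nonneg fun k _ => by positivity]
  refine (measure_biUnion_finset_le _ _).trans (Finset.sum_le_sum fun k _ => ?_)
  refine (measure_iUnion_fintype_le _ _).trans ?_
  refine (Finset.sum_le_card_nsmul _ _ (ENNReal.ofReal p ^ (k + 1)) fun q _ => ?_).trans ?_
  · by_cases hq : (pathWithChords q.1 q.2.1 q.2.2.1 q.2.2.2.1 q.2.2.2.2).card = k + 1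
    · simp only [hq, true_and]
      rw [erdosRenyiMeasure, bernoulliProduct_forall_mem_eq_true h0 h1, hq]
    · simp [hq]
  · rw [ENNReal.ofReal_mul (by positivity), ENNReal.ofReal_pow h0]
    simp only [Finset.card_univ, Fintype.card_prod, Fintype.card_fun, Fintype.card_fin,
      nsmul_eq_mul]
    refine mul_le_mul_left (le_of_eq ?_) _
    rw [← ENNReal.ofReal_natCast]
    congr 1
    push_cast
    ring

theorem sum_pathWithChords_le {n : ℕ} {p L : ℝ} (h0 : 0 ≤ p) (hn : 0 < n) (hL : 1 ≤ L)
    (hp : p ≤ (1 + (L ^ 2)⁻¹) / n) {K : ℕ} (hK : (K : ℝ) ≤ 200 * L) :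
    ∑ k ∈ Finset.range (K + 1), (n : ℝ) ^ k * (k : ℝ) ^ 4 * p ^ (k + 1) ≤
      201 ^ 5 * Real.exp 201 * (L ^ 5 / n) := by
  have hn' : (0 : ℝ) < n := by exact_mod_cast hn
  have hnp : (n : ℝ) * p ≤ 1 + (L ^ 2)⁻¹ := by
    rw [le_div_iff₀ hn'] at hp
    linarith
  have hK' : ((K + 1 : ℕ) : ℝ) ≤ 201 * L := by
    push_cast
    linarith
  have hexp : (1 + (L ^ 2)⁻¹) ^ (K + 1) ≤ Real.exp 201 := by
    calc (1 + (L ^ 2)⁻¹) ^ (K + 1) ≤ Real.exp ((L ^ 2)⁻¹) ^ (K + 1) := by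
          gcongr
          rw [add_comm]
          exact Real.add_one_le_exp _
      _ = Real.exp (((K + 1 : ℕ) : ℝ) * (L ^ 2)⁻¹) := (Real.exp_nat_mul _ _).symm
      _ ≤ Real.exp 201 := by
          gcongr
          rw [← div_eq_mul_inv, div_le_iff₀ (by positivity)]
          nlinarith
  have hterm : ∀ k ∈ Finset.range (K + 1), (n : ℝ) ^ k * (k : ℝ) ^ 4 * p ^ (k + 1) ≤
      (201 * L) ^ 4 * Real.exp 201 / n := by
    intro k hk
    have hkK : k + 1 ≤ K + 1 := Finset.mem_range.1 hk
    have hkL : (k : ℝ) ≤ 201 * L := by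
      refine le_trans ?_ hK'
      exact_mod_cast (Nat.le_succ k).trans hkK
    have hpow : ((n : ℝ) * p) ^ (k + 1) ≤ Real.exp 201 := by
      calc ((n : ℝ) * p) ^ (k + 1) ≤ (1 + (L ^ 2)⁻¹) ^ (k + 1) := by gcongr
        _ ≤ (1 + (L ^ 2)⁻¹) ^ (K + 1) :=
            pow_le_pow_right₀ (le_add_of_nonneg_right (by positivity)) hkK
        _ ≤ Real.exp 201 := hexp
    rw [le_div_iff₀ hn']
    calc (n : ℝ) ^ k * (k : ℝ) ^ 4 * p ^ (k + 1) * n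
        = (k : ℝ) ^ 4 * ((n : ℝ) * p) ^ (k + 1) := by ring
      _ ≤ (201 * L) ^ 4 * Real.exp 201 := by gcongr
  calc _ ≤ ((K + 1 : ℕ) : ℝ) * ((201 * L) ^ 4 * Real.exp 201 / n) := by
        simpa using Finset.sum_le_card_nsmul _ _ _ hterm
    _ ≤ 201 * L * ((201 * L) ^ 4 * Real.exp 201 / n) := by gcongr
    _ = 201 ^ 5 * Real.exp 201 * (L ^ 5 / n) := by ring

theorem compl_pathWithChordsEvent_subset (n : ℕ) (x : ℝ) :
    (pathWithChordsEvent n ⌊x⌋₊)ᶜ ⊆ {f | ¬ ∃ S : Finset (Fin n),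
      (S.card : ℝ) ≤ x ∧ ((graphOfFlip f).induce (S : Set (Fin n))).Connected ∧
      2 * S.card + 2 ≤ Nat.card {e : Fin n × Fin n //
        e.1 ∈ S ∧ e.2 ∈ S ∧ (graphOfFlip f).Adj e.1 e.2}} := by
  rintro f hf ⟨S, hSx, -, hS⟩
  have hE := card_adj_le_two_mul_card_edgesIn (G := graphOfFlip f) S
  obtain ⟨k, hk, v, a, b, c, d, hcard, hedge⟩ :=
    exists_pathWithChords (G := graphOfFlip f) S (by omega)
  refine hf (Set.mem_biUnion (x := k) ?_ (Set.mem_iUnion.2 ⟨(v, a, b, c, d), hcard, fun e he =>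
    mem_edgeSet_graphOfFlip (hedge e he)⟩))
  exact Finset.mem_coe.2 (Finset.mem_range.2
    (Nat.lt_succ_of_le (hk.trans (Nat.le_floor hSx))))

/-- Lemma 6.4.
For `p = p_n` with (eventually) `p ≤ (1+(log n)^{-2})/n`, whp `G ∼ G(n,p)` has no connected
subgraph with at most `200 log n` vertices and more edges than vertices (equivalently, with at
least two cycles); edge counts are taken over ordered adjacent pairs, so a vertex set `S` spans
more than `|S|` edges iff the ordered count is at least `2|S| + 2`. -/
theorem stmt18 (p : ℕ → ℝ) (hp0 : ∀ n, 0 ≤ p n) (hp1 : ∀ n, p n ≤ 1)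
    (hub : ∀ᶠ n : ℕ in atTop, p n ≤ (1 + ((Real.log n) ^ 2)⁻¹) / n) :
    Tendsto (fun n : ℕ =>
      erdosRenyiMeasure n (p n)
        {f | ¬ ∃ S : Finset (Fin n),
          (S.card : ℝ) ≤ 200 * Real.log n ∧
          ((graphOfFlip f).induce (S : Set (Fin n))).Connected ∧
          2 * S.card + 2 ≤ Nat.card {e : Fin n × Fin n //
            e.1 ∈ S ∧ e.2 ∈ S ∧ (graphOfFlip f).Adj e.1 e.2}})
      atTop (nhds 1) := by
  have hbound : Tendsto (fun n : ℕ => 1 - ENNReal.ofReal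
      (201 ^ 5 * Real.exp 201 * (Real.log n ^ 5 / n))) atTop (nhds 1) := by
    have hlog : Tendsto (fun n : ℕ => Real.log n ^ 5 / (n : ℝ)) atTop (nhds 0) := by
      simpa [Function.comp_def] using
        (Real.tendsto_pow_log_div_mul_add_atTop 1 0 5 one_ne_zero).comp
          tendsto_natCast_atTop_atTop
    have h := ENNReal.tendsto_ofReal (hlog.const_mul (201 ^ 5 * Real.exp 201))
    rw [mul_zero, ENNReal.ofReal_zero] at h
    simpa using ENNReal.Tendsto.sub (tendsto_const_nhds (x := (1 : ENNReal))) h (by simp)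
  have hprob : ∀ n, IsProbabilityMeasure (erdosRenyiMeasure n (p n)) := fun n =>
    isProbabilityMeasure_bernoulliProduct (hp0 n) (hp1 n)
  refine tendsto_of_tendsto_of_tendsto_of_le_of_le' hbound tendsto_const_nhds ?_
    (Eventually.of_forall fun n => prob_le_one)
  have hlarge : ∀ᶠ n : ℕ in atTop, 1 ≤ Real.log n :=
    (Real.tendsto_log_atTop.comp tendsto_natCast_atTop_atTop).eventually_ge_atTop 1
  filter_upwards [hub, hlarge, eventually_gt_atTop 0] with n hn hL hpos
  refine le_trans ?_ (measure_mono (compl_pathWithChordsEvent_subset n (200 * Real.log n)))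
  rw [prob_compl_eq_one_sub (Set.toFinite _).measurableSet]
  refine tsub_le_tsub_left ?_ 1
  refine (erdosRenyiMeasure_pathWithChordsEvent_le (hp0 n) (hp1 n) n _).trans ?_
  exact ENNReal.ofReal_le_ofReal (sum_pathWithChords_le (hp0 n) hpos hL hn
    (Nat.floor_le (by positivity)))
end
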